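/- Inhomogeneous collapsing estimate: there is a constant C > 0 such that for every T > 0, every Schwartz Γ₀ on ℝ², and every Schwartz forcing F(t,x,y), the Duhamel solution Γ(t) = e^{it(Δ_x−Δ_y)}Γ₀ + i∫₀^t e^{i(t−s)(Δ_x−Δ_y)}F(s) ds of 𝐒_±Γ = F satisfies ‖ |∇_x|^{1/2} ρ_Γ ‖_{L²([0,T]×ℝ_x)} ≤ C ( ‖Γ₀‖_{L²(ℝ²)} + ‖F‖_{L¹([0,T]; L²(ℝ²))} ). -/

import Mathlib

open MeasureTheory Complex SchwartzMap
open scoped ENNReal NNReal Real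

noncomputable section

/-- 1D Fourier transform with the convention `f̂ ξ = ∫ e^{-iξx} f x dx`. -/
def FT1 (f : ℝ → ℂ) (ξ : ℝ) : ℂ :=
  ∫ x : ℝ, Complex.exp (-(Complex.I) * (ξ : ℂ) * (x : ℂ)) * f x

/-- 1D inverse Fourier transform. -/
def IFT1 (g : ℝ → ℂ) (x : ℝ) : ℂ :=
  (2 * (Real.pi : ℂ))⁻¹ * ∫ ξ : ℝ, Complex.exp (Complex.I * (ξ : ℂ) * (x : ℂ)) * g ξ

/-- 2D Fourier transform (curried kernels). -/
def FT2 (f : ℝ → ℝ → ℂ) (ξ η : ℝ) : ℂ :=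
  ∫ x : ℝ, ∫ y : ℝ, Complex.exp (-(Complex.I) * ((ξ : ℂ) * x + (η : ℂ) * y)) * f x y

/-- 2D inverse Fourier transform. -/
def IFT2 (g : ℝ → ℝ → ℂ) (x y : ℝ) : ℂ :=
  ((2 * (Real.pi : ℂ)) ^ 2)⁻¹ *
    ∫ ξ : ℝ, ∫ η : ℝ, Complex.exp (Complex.I * ((ξ : ℂ) * x + (η : ℂ) * y)) * g ξ η

/-- Free propagator `e^{it(Δ_x − Δ_y)}`, Fourier multiplier `e^{it(η²−ξ²)}`. -/
def freeGamma (Γ₀ : ℝ → ℝ → ℂ) (t x y : ℝ) : ℂ :=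
  IFT2 (fun ξ η => Complex.exp (Complex.I * (t : ℂ) * ((η : ℂ) ^ 2 - (ξ : ℂ) ^ 2)) * FT2 Γ₀ ξ η) x y

/-- Free propagator `e^{it(Δ_x + Δ_y)}`, Fourier multiplier `e^{−it(ξ²+η²)}`. -/
def freeLambda (Λ₀ : ℝ → ℝ → ℂ) (t x y : ℝ) : ℂ :=
  IFT2 (fun ξ η => Complex.exp (-(Complex.I) * (t : ℂ) * ((ξ : ℂ) ^ 2 + (η : ℂ) ^ 2)) * FT2 Λ₀ ξ η) x y

/-- `|∇_x|^s`, Fourier multiplier `|ξ|^s` in one variable. -/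
def absDx (s : ℝ) (f : ℝ → ℂ) (x : ℝ) : ℂ :=
  IFT1 (fun ξ => ((|ξ| ^ s : ℝ) : ℂ) * FT1 f ξ) x

/-- `|∇_{x,y}|^s`, Fourier multiplier `(ξ²+η²)^{s/2}` on `ℝ²`. -/
def absDxy (s : ℝ) (f : ℝ → ℝ → ℂ) (x y : ℝ) : ℂ :=
  IFT2 (fun ξ η => (((ξ ^ 2 + η ^ 2) ^ (s / 2) : ℝ) : ℂ) * FT2 f ξ η) x y

/-- `|∇_{x+y}|^s`, Fourier multiplier `(|ξ+η|/2)^s` on `ℝ²`. -/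
def absDxpy (s : ℝ) (f : ℝ → ℝ → ℂ) (x y : ℝ) : ℂ :=
  IFT2 (fun ξ η => (((|ξ + η| / 2) ^ s : ℝ) : ℂ) * FT2 f ξ η) x y

/-- `⟨∇_x⟩^s`, Fourier multiplier `(1+ξ²)^{s/2}` in one variable. -/
def japDx (s : ℝ) (f : ℝ → ℂ) (x : ℝ) : ℂ :=
  IFT1 (fun ξ => (((1 + ξ ^ 2) ^ (s / 2) : ℝ) : ℂ) * FT1 f ξ) x

/-- `⟨∇_{x,y}⟩^s`, Fourier multiplier `(1+ξ²+η²)^{s/2}` on `ℝ²`. -/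
def japDxy (s : ℝ) (f : ℝ → ℝ → ℂ) (x y : ℝ) : ℂ :=
  IFT2 (fun ξ η => (((1 + ξ ^ 2 + η ^ 2) ^ (s / 2) : ℝ) : ℂ) * FT2 f ξ η) x y

/-- `L²` norm of a kernel on `ℝ²`. -/
def L2K (f : ℝ → ℝ → ℂ) : ℝ≥0∞ :=
  eLpNorm (fun p : ℝ × ℝ => f p.1 p.2) 2 volume

/-- `L²` norm on `ℝ`. -/
def L2F (f : ℝ → ℂ) : ℝ≥0∞ := eLpNorm f 2 volume

/-- Mixed norm `L^q(μ(dt)) L^r(dx)` for a function of `(t,x)`. -/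
def MixedN2 (μ : Measure ℝ) (q r : ℝ≥0∞) (u : ℝ → ℝ → ℂ) : ℝ≥0∞ :=
  eLpNorm (fun t => (eLpNorm (u t) r volume).toReal) q μ

/-- Mixed norm `L^q(μ(dt)) L^r(dx) L^s(dy)` for a function of `(t,x,y)`. -/
def MixedN3 (μ : Measure ℝ) (q r s : ℝ≥0∞) (u : ℝ → ℝ → ℝ → ℂ) : ℝ≥0∞ :=
  eLpNorm (fun t => (eLpNorm (fun x => (eLpNorm (u t x) s volume).toReal) r volume).toReal) q μ

/-- Spacetime Fourier transform on `ℝ_t × ℝ_x`. -/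
def FTtx (u : ℝ → ℝ → ℂ) (τ ξ : ℝ) : ℂ :=
  ∫ t : ℝ, ∫ x : ℝ, Complex.exp (-(Complex.I) * ((τ : ℂ) * t + (ξ : ℂ) * x)) * u t x

/-- Spacetime Fourier transform on `ℝ_t × ℝ²`. -/
def FTtxy (u : ℝ → ℝ → ℝ → ℂ) (τ ξ η : ℝ) : ℂ :=
  ∫ t : ℝ, ∫ x : ℝ, ∫ y : ℝ,
    Complex.exp (-(Complex.I) * ((τ : ℂ) * t + (ξ : ℂ) * x + (η : ℂ) * y)) * u t x y

/-- Bourgain space norm `X^b` associated to `𝐒 = (1/i)∂_t − Δ_x − Δ_y`. -/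
def XbNorm (b : ℝ) (u : ℝ → ℝ → ℝ → ℂ) : ℝ≥0∞ :=
  eLpNorm (fun p : ℝ × ℝ × ℝ =>
    (((1 + |p.1 + p.2.1 ^ 2 + p.2.2 ^ 2|) ^ b : ℝ) : ℂ) * FTtxy u p.1 p.2.1 p.2.2) 2 volume

/-- Duhamel solution of `𝐒_± Γ = F` with data `Γ₀`. -/
def duhamelGamma (Γ₀ : ℝ → ℝ → ℂ) (F : ℝ → ℝ → ℝ → ℂ) (t x y : ℝ) : ℂ :=
  freeGamma Γ₀ t x y + Complex.I * ∫ s in (0:ℝ)..t, freeGamma (F s) (t - s) x y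

/-- Duhamel solution of `𝐒 Λ = F` with data `Λ₀`. -/
def duhamelLambda (Λ₀ : ℝ → ℝ → ℂ) (F : ℝ → ℝ → ℝ → ℂ) (t x y : ℝ) : ℂ :=
  freeLambda Λ₀ t x y + Complex.I * ∫ s in (0:ℝ)..t, freeLambda (F s) (t - s) x y

/-! ### Plancherel inequalities -/

lemma eLpNorm_two_sq {α E : Type*} [MeasurableSpace α] [NormedAddCommGroup E] (μ : Measure α)
    (f : α → E) : eLpNorm f 2 μ ^ 2 = ∫⁻ x, ‖f x‖ₑ ^ 2 ∂μ := by
  simpa using! eLpNorm_nnreal_pow_eq_lintegral (f := f) (p := 2) (μ := μ) (by norm_num)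

/-- The Fourier transform does not increase the `L²` norm of an integrable function. -/
lemma lintegral_fourier_sq_le {f : ℝ → ℂ} (hf : Integrable f) :
    ∫⁻ w : ℝ, ‖FourierTransform.fourier f w‖ₑ ^ 2 ≤ ∫⁻ x, ‖f x‖ₑ ^ 2 := by
  by_cases hf2 : MemLp f 2 volume
  swap
  · have : ∫⁻ x, ‖f x‖ₑ ^ 2 = ⊤ := by
      by_contra h
      apply hf2
      refine ⟨hf.1, ?_⟩
      rw [eLpNorm_lt_top_iff_lintegral_rpow_enorm_lt_top (by simp) (by simp)]
      simpa [lt_top_iff_ne_top] using h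
    rw [this]; exact le_top
  set L : Lp ℂ 2 (volume : Measure ℝ) := FourierTransform.fourier (hf2.toLp f) with hL
  have hcont : Continuous (FourierTransform.fourier f) :=
    VectorFourier.fourierIntegral_continuous Real.continuous_fourierChar
      (by exact continuous_inner) hf
  have hae : ∀ᵐ w : ℝ, (L : ℝ → ℂ) w = FourierTransform.fourier f w := by
    apply ae_eq_of_integral_contDiff_smul_eq
    · exact (Lp.memLp L).locallyIntegrable (by norm_num)
    · exact hcont.locallyIntegrable
    · intro g g_smooth g_cpt
      have hg₁ : HasCompactSupport (Complex.ofRealCLM ∘ g) := g_cpt.comp_left rfl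
      have hg₂ : ContDiff ℝ (⊤ : ℕ∞) (Complex.ofRealCLM ∘ g) := by fun_prop
      set φ : 𝓢(ℝ, ℂ) := hg₁.toSchwartzMap hg₂ with hφ
      calc ∫ x, g x • (L : ℝ → ℂ) x = Lp.toTemperedDistribution L φ := by simp [hφ]
        _ = Lp.toTemperedDistribution (hf2.toLp f) (FourierTransform.fourier φ) := by
          rw [hL, ← Lp.fourier_toTemperedDistribution_eq, TemperedDistribution.fourier_apply]
        _ = ∫ x, (FourierTransform.fourier φ) x • f x := by
          rw [Lp.toTemperedDistribution_apply]
          apply integral_congr_ae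
          filter_upwards [hf2.coeFn_toLp] with x hx
          rw [hx]
        _ = ∫ x, φ x • FourierTransform.fourier f x := by
          have := VectorFourier.integral_fourierIntegral_smul_eq_flip (μ := volume) (ν := volume)
            (L := innerₗ ℝ) Real.continuous_fourierChar (by exact continuous_inner)
            φ.integrable hf
          rw [flip_innerₗ] at this
          exact this
        _ = _ := by simp [hφ]
  have e1 : ∫⁻ w : ℝ, ‖FourierTransform.fourier f w‖ₑ ^ 2 = ∫⁻ w : ℝ, ‖(L : ℝ → ℂ) w‖ₑ ^ 2 := by
    apply lintegral_congr_ae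
    filter_upwards [hae] with x hx
    rw [hx]
  have e2 : eLpNorm (L : ℝ → ℂ) 2 volume = eLpNorm f 2 volume := by
    have h := Lp.norm_fourier_eq (hf2.toLp f)
    rw [← hL, Lp.norm_def, Lp.norm_def, ENNReal.toReal_eq_toReal_iff' (Lp.eLpNorm_ne_top _)
      (Lp.eLpNorm_ne_top _)] at h
    rw [h]
    exact eLpNorm_congr_ae hf2.coeFn_toLp
  rw [e1]
  rw [← eLpNorm_two_sq, ← eLpNorm_two_sq, e2]

lemma FT1_eq_fourier (f : ℝ → ℂ) (ξ : ℝ) :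
    FT1 f ξ = FourierTransform.fourier f ((2 * π)⁻¹ * ξ) := by
  rw [Real.fourier_real_eq_integral_exp_smul, FT1]
  congr 1
  ext x
  rw [smul_eq_mul]
  congr 2
  push_cast
  have : (π : ℂ) ≠ 0 := by exact_mod_cast Real.pi_ne_zero
  field_simp

lemma FT1_of_not_integrable {f : ℝ → ℂ} (hf : ¬ Integrable f) (ξ : ℝ) : FT1 f ξ = 0 := by
  apply integral_undef
  intro h
  apply hf
  have h2 := h.bdd_mul (c := 1) (f := fun x : ℝ => Complex.exp (Complex.I * ξ * x))
    (by fun_prop) (Filter.Eventually.of_forall fun x => by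
      rw [show Complex.I * ξ * x = ((ξ * x : ℝ) : ℂ) * Complex.I by push_cast; ring,
        Complex.norm_exp_ofReal_mul_I])
  convert h2 using 2 with x
  rw [← mul_assoc, ← Complex.exp_add]
  ring_nf
  simp

lemma lintegral_comp_mul_left (f : ℝ → ℝ≥0∞) {a : ℝ} (ha : a ≠ 0) :
    ∫⁻ x, f (a * x) = ENNReal.ofReal |a|⁻¹ * ∫⁻ x, f x := by
  have h := lintegral_map_equiv (μ := volume) f (Homeomorph.mulLeft₀ a ha).toMeasurableEquiv
  have h' := Real.map_volume_mul_left ha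
  simp only [Homeomorph.toMeasurableEquiv_coe, Homeomorph.coe_mulLeft₀] at h
  rw [← h, h', lintegral_smul_measure, abs_inv, smul_eq_mul]

lemma lintegral_FT1_sq_le (f : ℝ → ℂ) :
    ∫⁻ ξ, ‖FT1 f ξ‖ₑ ^ 2 ≤ ENNReal.ofReal (2 * π) * ∫⁻ x, ‖f x‖ₑ ^ 2 := by
  by_cases hf : Integrable f
  · simp_rw [FT1_eq_fourier]
    rw [lintegral_comp_mul_left (fun w => ‖FourierTransform.fourier f w‖ₑ ^ 2) (by positivity),
      abs_of_pos (by positivity), inv_inv]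
    exact mul_le_mul_right (lintegral_fourier_sq_le hf) _
  · simp [FT1_of_not_integrable hf]

lemma IFT1_eq_FT1 (g : ℝ → ℂ) (x : ℝ) : IFT1 g x = (2 * (π : ℂ))⁻¹ * FT1 g (-x) := by
  simp only [IFT1, FT1]
  congr 2
  ext ξ
  congr 2
  push_cast
  ring

lemma enorm_two_pi_inv : ‖(2 * (π : ℂ))⁻¹‖ₑ = ENNReal.ofReal (2 * π)⁻¹ := by
  rw [← ofReal_norm]
  simp [abs_of_pos Real.pi_pos]

lemma lintegral_IFT1_sq_le (g : ℝ → ℂ) :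
    ∫⁻ x, ‖IFT1 g x‖ₑ ^ 2 ≤ ENNReal.ofReal (2 * π)⁻¹ * ∫⁻ ξ, ‖g ξ‖ₑ ^ 2 := by
  simp_rw [IFT1_eq_FT1, enorm_mul, mul_pow]
  rw [lintegral_const_mul' _ _ (by rw [enorm_two_pi_inv]; simp),
    lintegral_neg_eq_self (fun x => ‖FT1 g x‖ₑ ^ 2), enorm_two_pi_inv]
  calc _ ≤ ENNReal.ofReal (2 * π)⁻¹ ^ 2 * (ENNReal.ofReal (2 * π) * ∫⁻ x, ‖g x‖ₑ ^ 2) := by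
        gcongr; exact lintegral_FT1_sq_le g
    _ = _ := by
        rw [← mul_assoc, ← ENNReal.ofReal_pow (by positivity),
          ← ENNReal.ofReal_mul (by positivity)]
        congr 2
        field_simp

/-- Fourier inversion: `FT1` inverts `IFT1` on continuous integrable functions as soon as
the integral defining `FT1` converges. -/
lemma FT1_IFT1 {g : ℝ → ℂ} (hc : Continuous g) (hg : Integrable g) (hi : Integrable (IFT1 g))
    (ξ : ℝ) : FT1 (IFT1 g) ξ = g ξ := by
  have e (x : ℝ) : IFT1 g x =
      (2 * (π : ℂ))⁻¹ * FourierTransformInv.fourierInv g ((2 * π)⁻¹ * x) := by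
    rw [IFT1_eq_FT1, FT1_eq_fourier, Real.fourierInv_eq_fourier_neg, mul_neg]
  have hpi : (π : ℂ) ≠ 0 := by exact_mod_cast Real.pi_ne_zero
  have hI : Integrable (FourierTransformInv.fourierInv g) := by
    have h1 : Integrable (fun x => FourierTransformInv.fourierInv g ((2 * π)⁻¹ * x)) := by
      have := hi.const_mul (2 * (π : ℂ))
      refine this.congr (Filter.Eventually.of_forall fun x => ?_)
      simp only [e]
      field_simp
    exact (integrable_comp_mul_left_iff _ (by positivity)).1 h1
  have hF : Integrable (FourierTransform.fourier g) := by
    have h2 := hI.comp_neg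
    refine h2.congr (Filter.Eventually.of_forall fun x => ?_)
    simp [Real.fourierInv_eq_fourier_neg]
  have key := congrFun (hc.fourier_fourierInv_eq hg hF) ξ
  rw [← key, Real.fourier_real_eq_integral_exp_smul, FT1]
  have h := Measure.integral_comp_mul_left (fun v : ℝ =>
    Complex.exp (↑(-2 * π * v * ξ) * Complex.I) • FourierTransformInv.fourierInv g v) (2 * π)⁻¹
  rw [inv_inv, abs_of_pos (by positivity), ← inv_smul_eq_iff₀ (by positivity)] at h
  rw [← h, ← integral_smul]
  congr 1
  ext x
  rw [e, Complex.real_smul, smul_eq_mul, ← mul_assoc, ← mul_assoc, mul_comm (Complex.exp _)]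
  push_cast
  congr 3
  field_simp

lemma FT2_eq_FT1_FT1 (f : ℝ → ℝ → ℂ) (ξ η : ℝ) :
    FT2 f ξ η = FT1 (fun x => FT1 (f x) η) ξ := by
  simp only [FT2, FT1, ← integral_const_mul]
  congr 1
  ext x
  congr 1
  ext y
  rw [← mul_assoc, ← Complex.exp_add]
  ring_nf

lemma measurable_FT1 {α : Type*} [MeasurableSpace α] {f : α → ℝ → ℂ}
    (hf : Measurable (fun p : α × ℝ => f p.1 p.2)) :
    Measurable (fun p : α × ℝ => FT1 (f p.1) p.2) := by
  unfold FT1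
  apply StronglyMeasurable.measurable
  refine StronglyMeasurable.integral_prod_right (f := fun (p : α × ℝ) (x : ℝ) =>
    Complex.exp (-(Complex.I) * (p.2 : ℂ) * (x : ℂ)) * f p.1 x) ?_
  apply Measurable.stronglyMeasurable
  have h : Measurable (fun q : (α × ℝ) × ℝ => f q.1.1 q.2) :=
    hf.comp ((measurable_fst.comp measurable_fst).prodMk measurable_snd)
  exact Measurable.mul (by fun_prop) h

attribute [local irreducible] FT1 FT2 in
lemma measurable_FT2 {α : Type*} [MeasurableSpace α] {f : α → ℝ → ℝ → ℂ}
    (hf : Measurable (fun p : α × ℝ × ℝ => f p.1 p.2.1 p.2.2)) :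
    Measurable (fun p : α × ℝ × ℝ => FT2 (f p.1) p.2.1 p.2.2) := by
  simp_rw [FT2_eq_FT1_FT1]
  have h1 : Measurable (fun p : (α × ℝ) × ℝ => FT1 (f p.1.1 p.1.2) p.2) :=
    measurable_FT1 (f := fun (a : α × ℝ) => f a.1 a.2)
      (hf.comp ((measurable_fst.comp measurable_fst).prodMk
        ((measurable_snd.comp measurable_fst).prodMk measurable_snd)))
  have h2 : Measurable (fun p : (α × ℝ) × ℝ => FT1 (fun x => FT1 (f p.1.1 x) p.1.2) p.2) :=
    measurable_FT1 (f := fun (a : α × ℝ) x => FT1 (f a.1 x) a.2)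
      (h1.comp (((measurable_fst.comp measurable_fst).prodMk measurable_snd).prodMk
        (measurable_snd.comp measurable_fst)))
  exact h2.comp ((measurable_fst.prodMk (measurable_snd.comp measurable_snd)).prodMk
    (measurable_fst.comp measurable_snd))

attribute [local irreducible] FT1 FT2 in
lemma measurable_FT2_uncurry {f : ℝ → ℝ → ℂ} (hf : Measurable (fun p : ℝ × ℝ => f p.1 p.2)) :
    Measurable (fun p : ℝ × ℝ => FT2 f p.1 p.2) :=
  (measurable_FT2 (α := Unit) (f := fun _ => f) (hf.comp measurable_snd)).comp
    (measurable_const (a := ()) |>.prodMk measurable_id)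

attribute [local irreducible] FT1 FT2 in
lemma lintegral_FT2_sq_le {f : ℝ → ℝ → ℂ} (hf : Measurable (fun p : ℝ × ℝ => f p.1 p.2)) :
    ∫⁻ ξ, ∫⁻ η, ‖FT2 f ξ η‖ₑ ^ 2 ≤
      ENNReal.ofReal (2 * π) ^ 2 * ∫⁻ x, ∫⁻ y, ‖f x y‖ₑ ^ 2 := by
  have m1 := measurable_FT1 hf
  have m2 := measurable_FT2_uncurry hf
  rw [lintegral_lintegral_swap (by fun_prop)]
  simp_rw [FT2_eq_FT1_FT1]
  calc _ ≤ ∫⁻ η, ENNReal.ofReal (2 * π) * ∫⁻ x, ‖FT1 (f x) η‖ₑ ^ 2 := by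
        apply lintegral_mono
        intro η
        exact lintegral_FT1_sq_le _
    _ = ENNReal.ofReal (2 * π) * ∫⁻ x, ∫⁻ η, ‖FT1 (f x) η‖ₑ ^ 2 := by
        rw [lintegral_const_mul' _ _ ENNReal.ofReal_ne_top, lintegral_lintegral_swap]
        have : Measurable (fun p : ℝ × ℝ => FT1 (f p.2) p.1) := m1.comp measurable_swap
        exact (this.enorm.pow_const 2).aemeasurable
    _ ≤ ENNReal.ofReal (2 * π) * ∫⁻ x, ENNReal.ofReal (2 * π) * ∫⁻ y, ‖f x y‖ₑ ^ 2 := by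
        refine mul_le_mul_right (lintegral_mono fun x => ?_) _
        exact lintegral_FT1_sq_le _
    _ = _ := by
        rw [lintegral_const_mul' _ _ ENNReal.ofReal_ne_top, ← mul_assoc, sq]

/-! ### The collapsed density on the Fourier side -/

/-- The Fourier transform in `x` of the diagonal of the free evolution with frequency
profile `φ`. -/
def collapse (φ : ℝ → ℝ → ℂ) (t ζ : ℝ) : ℂ :=
  (2 * (π : ℂ))⁻¹ * ∫ ξ : ℝ,
    Complex.exp (Complex.I * t * (((ζ - ξ : ℝ) : ℂ) ^ 2 - (ξ : ℂ) ^ 2)) * φ ξ (ζ - ξ)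

lemma collapse_eq_FT1 (φ : ℝ → ℝ → ℂ) (t ζ : ℝ) :
    collapse φ t ζ = (2 * (π : ℂ))⁻¹ * Complex.exp ((t * ζ ^ 2 : ℝ) * Complex.I) *
      FT1 (fun ξ => φ ξ (ζ - ξ)) (2 * ζ * t) := by
  rw [collapse, FT1, mul_assoc, ← integral_const_mul (Complex.exp _)]
  congr 2
  ext ξ
  rw [← mul_assoc, ← Complex.exp_add]
  push_cast
  ring_nf

lemma enorm_collapse (φ : ℝ → ℝ → ℂ) (t ζ : ℝ) :
    ‖collapse φ t ζ‖ₑ = ENNReal.ofReal (2 * π)⁻¹ * ‖FT1 (fun ξ => φ ξ (ζ - ξ)) (2 * ζ * t)‖ₑ := by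
  have : ‖Complex.exp ((t * ζ ^ 2 : ℝ) * Complex.I)‖ₑ = 1 := by
    rw [← ofReal_norm, Complex.norm_exp_ofReal_mul_I]
    simp
  rw [collapse_eq_FT1, enorm_mul, enorm_mul, enorm_two_pi_inv, this, mul_one]

attribute [local irreducible] FT1 FT2 in
lemma measurable_collapse {α : Type*} [MeasurableSpace α] {φ : α → ℝ → ℝ → ℂ}
    (hφ : Measurable (fun p : α × ℝ × ℝ => φ p.1 p.2.1 p.2.2)) :
    Measurable (fun p : α × ℝ × ℝ => collapse (φ p.1) p.2.1 p.2.2) := by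
  simp_rw [collapse_eq_FT1]
  have h1 : Measurable (fun p : (α × ℝ) × ℝ => FT1 (fun ξ => φ p.1.1 ξ (p.1.2 - ξ)) p.2) := by
    apply measurable_FT1 (f := fun (a : α × ℝ) ξ => φ a.1 ξ (a.2 - ξ))
    have : Measurable (fun p : (α × ℝ) × ℝ => (p.1.1, p.2, p.1.2 - p.2)) := by fun_prop
    exact hφ.comp this
  have h2 : Measurable (fun p : α × ℝ × ℝ => ((p.1, p.2.2), 2 * p.2.2 * p.2.1)) := by fun_prop
  exact Measurable.mul (by fun_prop) (h1.comp h2)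

attribute [local irreducible] collapse in
lemma measurable_collapse_uncurry {φ : ℝ → ℝ → ℂ}
    (hφ : Measurable (fun p : ℝ × ℝ => φ p.1 p.2)) :
    Measurable (fun p : ℝ × ℝ => collapse φ p.1 p.2) :=
  (measurable_collapse (α := Unit) (φ := fun _ => φ) (hφ.comp measurable_snd)).comp
    (measurable_const (a := ()) |>.prodMk measurable_id)

/-- The homogeneous collapsing estimate for a fixed frequency `ζ`. -/
lemma lintegral_collapse_sq_le (φ : ℝ → ℝ → ℂ) (ζ : ℝ) :
    ∫⁻ t, (ENNReal.ofReal (|ζ| ^ (1 / 2 : ℝ)) * ‖collapse φ t ζ‖ₑ) ^ 2 ≤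
      ∫⁻ ξ, ‖φ ξ (ζ - ξ)‖ₑ ^ 2 := by
  rcases eq_or_ne ζ 0 with rfl | hζ
  · simp
  simp_rw [enorm_collapse, mul_pow, ← mul_assoc]
  rw [lintegral_const_mul' _ _ (by finiteness),
    lintegral_comp_mul_left (fun w => ‖FT1 (fun ξ => φ ξ (ζ - ξ)) w‖ₑ ^ 2) (by simpa using hζ)]
  calc _ ≤ _ := mul_le_mul_right (mul_le_mul_right (lintegral_FT1_sq_le _) _) _
    _ = ENNReal.ofReal ((|ζ| ^ (1 / 2 : ℝ)) ^ 2 * ((2 * π)⁻¹) ^ 2 * (|2 * ζ|⁻¹ * (2 * π))) *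
        ∫⁻ ξ, ‖φ ξ (ζ - ξ)‖ₑ ^ 2 := by
      rw [ENNReal.ofReal_mul (p := _ * _) (by positivity),
        ENNReal.ofReal_mul (p := _ ^ 2) (by positivity),
        ENNReal.ofReal_mul (p := |2 * ζ|⁻¹) (by positivity), ENNReal.ofReal_pow (by positivity),
        ENNReal.ofReal_pow (by positivity)]
      ring
    _ ≤ 1 * ∫⁻ ξ, ‖φ ξ (ζ - ξ)‖ₑ ^ 2 := by
      refine mul_le_mul_left ?_ _
      rw [← Real.rpow_natCast, ← Real.rpow_mul (by positivity), ENNReal.ofReal_le_one, abs_mul]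
      have h0 : 0 < |ζ| := abs_pos.2 hζ
      have h3 := Real.pi_gt_three
      norm_num
      field_simp
      linarith
    _ = _ := one_mul _

attribute [local irreducible] collapse in
/-- The homogeneous collapsing estimate. -/
lemma lintegral_lintegral_collapse_sq_le {φ : ℝ → ℝ → ℂ}
    (hφ : Measurable (fun p : ℝ × ℝ => φ p.1 p.2)) :
    ∫⁻ t, ∫⁻ ζ, (ENNReal.ofReal (|ζ| ^ (1 / 2 : ℝ)) * ‖collapse φ t ζ‖ₑ) ^ 2 ≤
      ∫⁻ ξ, ∫⁻ η, ‖φ ξ η‖ₑ ^ 2 := by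
  have m := measurable_collapse_uncurry hφ
  have m2 : Measurable (fun p : ℝ × ℝ => φ p.2 (p.1 - p.2)) :=
    hφ.comp (measurable_snd.prodMk (measurable_fst.sub measurable_snd))
  rw [lintegral_lintegral_swap (by fun_prop)]
  calc _ ≤ ∫⁻ ζ, ∫⁻ ξ, ‖φ ξ (ζ - ξ)‖ₑ ^ 2 := lintegral_mono fun ζ => lintegral_collapse_sq_le φ ζ
    _ = ∫⁻ ξ, ∫⁻ ζ, ‖φ ξ (ζ - ξ)‖ₑ ^ 2 := lintegral_lintegral_swap (by fun_prop)
    _ = _ := by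
      congr 1
      ext ξ
      exact lintegral_sub_right_eq_self (fun η => ‖φ ξ η‖ₑ ^ 2) ξ

/-- Minkowski's integral inequality in `L²`. -/
lemma lintegral_lintegral_sq_le {α β : Type*} [MeasurableSpace α] [MeasurableSpace β]
    {μ : Measure α} {ν : Measure β} [SFinite μ] [SFinite ν] {K : α → β → ℝ≥0∞}
    (hK : Measurable (Function.uncurry K)) :
    ∫⁻ w, (∫⁻ s, K s w ∂μ) ^ 2 ∂ν ≤ (∫⁻ s, (∫⁻ w, K s w ^ 2 ∂ν) ^ (1 / 2 : ℝ) ∂μ) ^ 2 := by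
  have hs (s : α) : Measurable (K s) := hK.of_uncurry_left
  have hw (w : β) : Measurable (fun s => K s w) := hK.of_uncurry_right
  have hN : Measurable (fun s => (∫⁻ w, K s w ^ 2 ∂ν) ^ (1 / 2 : ℝ)) :=
    (Measurable.lintegral_prod_right' (f := fun p : α × β => K p.1 p.2 ^ 2)
      (hK.pow_const 2)).pow_const _
  have sq_eq {f : α → ℝ≥0∞} (hf : Measurable f) :
      (∫⁻ s, f s ∂μ) ^ 2 = ∫⁻ p, f p.1 * f p.2 ∂(μ.prod μ) := by
    rw [lintegral_prod_mul hf.aemeasurable hf.aemeasurable, sq]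
  have m3 : Measurable (fun q : β × α × α => K q.2.1 q.1 * K q.2.2 q.1) := by
    have a1 : Measurable (fun q : β × α × α => (q.2.1, q.1)) := by fun_prop
    have a2 : Measurable (fun q : β × α × α => (q.2.2, q.1)) := by fun_prop
    exact (hK.comp a1).mul (hK.comp a2)
  calc _ = ∫⁻ w, ∫⁻ p, K p.1 w * K p.2 w ∂(μ.prod μ) ∂ν := by
        congr 1; ext w; exact sq_eq (hw w)
    _ = ∫⁻ p, ∫⁻ w, K p.1 w * K p.2 w ∂ν ∂(μ.prod μ) :=
        lintegral_lintegral_swap m3.aemeasurable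
    _ ≤ ∫⁻ p, (∫⁻ w, K p.1 w ^ 2 ∂ν) ^ (1 / 2 : ℝ) * (∫⁻ w, K p.2 w ^ 2 ∂ν) ^ (1 / 2 : ℝ)
          ∂(μ.prod μ) := by
        apply lintegral_mono
        intro p
        have := ENNReal.lintegral_mul_le_Lp_mul_Lq ν Real.HolderConjugate.two_two
          (hs p.1).aemeasurable (hs p.2).aemeasurable
        simpa using this
    _ = _ := (sq_eq hN).symm

/-! ### Frequency decay of slices of Schwartz functions -/

lemma continuous_FT1 (f : ℝ → ℂ) : Continuous (FT1 f) := by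
  by_cases hf : Integrable f
  · have hcont : Continuous (FourierTransform.fourier f) :=
      VectorFourier.fourierIntegral_continuous Real.continuous_fourierChar
        (by exact continuous_inner) hf
    have : FT1 f = fun ξ => FourierTransform.fourier f ((2 * π)⁻¹ * ξ) :=
      funext fun ξ => FT1_eq_fourier f ξ
    rw [this]
    fun_prop
  · have : FT1 f = fun _ => 0 := funext fun ξ => FT1_of_not_integrable hf ξ
    rw [this]
    exact continuous_const

lemma FT1_deriv {f f' : ℝ → ℂ} (h : ∀ x, HasDerivAt f (f' x) x) (hf : Integrable f)
    (hf' : Integrable f') (ξ : ℝ) : FT1 f' ξ = Complex.I * ξ * FT1 f ξ := by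
  have hd : deriv f = f' := funext fun x => (h x).deriv
  have := congrFun (Real.fourier_deriv hf (fun x => (h x).differentiableAt) (hd ▸ hf'))
    ((2 * π)⁻¹ * ξ)
  rw [FT1_eq_fourier, FT1_eq_fourier, ← hd, this, smul_eq_mul]
  have hpi : (π : ℂ) ≠ 0 := by exact_mod_cast Real.pi_ne_zero
  push_cast
  congr 1
  field_simp

lemma FT1_sub_deriv_deriv {f f' f'' : ℝ → ℂ} (h : ∀ x, HasDerivAt f (f' x) x)
    (h' : ∀ x, HasDerivAt f' (f'' x) x) (hf : Integrable f) (hf' : Integrable f')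
    (hf'' : Integrable f'') (ξ : ℝ) :
    FT1 (fun x => f x - f'' x) ξ = (1 + (ξ : ℂ) ^ 2) * FT1 f ξ := by
  have e : FT1 (fun x => f x - f'' x) ξ = FT1 f ξ - FT1 f'' ξ := by
    simp only [FT1, mul_sub]
    have hb {g : ℝ → ℂ} (hg : Integrable g) :
        Integrable (fun x : ℝ => Complex.exp (-Complex.I * ξ * x) * g x) := by
      refine hg.bdd_mul (c := 1) (by fun_prop) (Filter.Eventually.of_forall fun x => ?_)
      rw [show -Complex.I * ξ * x = ((-(ξ * x) : ℝ) : ℂ) * Complex.I by push_cast; ring,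
        Complex.norm_exp_ofReal_mul_I]
    exact integral_sub (hb hf) (hb hf'')
  rw [e, FT1_deriv h' hf' hf'', FT1_deriv h hf hf']
  linear_combination -(ξ : ℂ) ^ 2 * FT1 f ξ * Complex.I_sq

lemma norm_FT1_le (f : ℝ → ℂ) (ξ : ℝ) : ‖FT1 f ξ‖ ≤ ∫ x, ‖f x‖ := by
  refine (norm_integral_le_integral_norm _).trans_eq ?_
  congr 1
  ext x
  rw [norm_mul, show -Complex.I * ξ * x = ((-(ξ * x) : ℝ) : ℂ) * Complex.I by push_cast; ring,
    Complex.norm_exp_ofReal_mul_I, one_mul]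

lemma FT2_eq_FT1_FT1_swap {f : ℝ → ℝ → ℂ}
    (hf : Integrable (fun p : ℝ × ℝ => f p.1 p.2)) (ξ η : ℝ) :
    FT2 f ξ η = FT1 (fun y => FT1 (fun x => f x y) ξ) η := by
  have : FT2 f ξ η = FT2 (fun y x => f x y) η ξ := by
    rw [FT2, integral_integral_swap]
    · simp only [FT2]
      congr 1
      ext y
      congr 1
      ext x
      ring_nf
    · refine hf.bdd_mul (c := 1) (f := fun p : ℝ × ℝ =>
        Complex.exp (-Complex.I * ((ξ : ℂ) * p.1 + (η : ℂ) * p.2)))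
        (by fun_prop) (Filter.Eventually.of_forall fun p => ?_)
      rw [show -Complex.I * ((ξ : ℂ) * p.1 + (η : ℂ) * p.2) =
        ((-(ξ * p.1 + η * p.2) : ℝ) : ℂ) * Complex.I by push_cast; ring,
        Complex.norm_exp_ofReal_mul_I]
  rw [this, FT2_eq_FT1_FT1]

lemma integrable_inv_mul_inv :
    Integrable (fun p : ℝ × ℝ => (1 + p.1 ^ 2)⁻¹ * (1 + p.2 ^ 2)⁻¹) :=
  integrable_inv_one_add_sq.mul_prod integrable_inv_one_add_sq

section Slices

variable {V : Type*} [NormedAddCommGroup V] [NormedSpace ℝ V]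

lemma exists_norm_schwartz_le (F : 𝓢(V, ℂ)) : ∃ C : ℝ, 0 ≤ C ∧ ∀ (v : V) (x y : ℝ),
    |x| ≤ ‖v‖ → |y| ≤ ‖v‖ → ‖F v‖ ≤ C * ((1 + x ^ 2)⁻¹ * (1 + y ^ 2)⁻¹) := by
  refine ⟨2 ^ 4 * ((Finset.Iic (4, 0)).sup fun m => SchwartzMap.seminorm ℝ m.1 m.2) F,
    by positivity, fun v x y hx hy => ?_⟩
  have h := SchwartzMap.one_add_le_sup_seminorm_apply (𝕜 := ℝ) (m := (4, 0)) (k := 4) (n := 0)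
    le_rfl le_rfl F v
  rw [norm_iteratedFDeriv_zero] at h
  rw [← mul_inv, ← div_eq_mul_inv, le_div_iff₀ (by positivity)]
  refine le_trans ?_ h
  rw [mul_comm]
  refine mul_le_mul_of_nonneg_right ?_ (norm_nonneg _)
  have hv := norm_nonneg v
  have key (z : ℝ) (hz : |z| ≤ ‖v‖) : 1 + z ^ 2 ≤ (1 + ‖v‖) ^ 2 := by
    have := sq_le_sq' (by linarith [abs_nonneg z]) hz
    rw [sq_abs] at this
    nlinarith
  calc (1 + x ^ 2) * (1 + y ^ 2) ≤ (1 + ‖v‖) ^ 2 * (1 + ‖v‖) ^ 2 := by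
        gcongr <;> exact key _ ‹_›
    _ = _ := by ring

/-- The affine map `(x, y) ↦ c + x e₁ + y e₂` does not contract either coordinate. -/
def IsSlice (c e₁ e₂ : V) : Prop :=
  ∀ x y : ℝ, |x| ≤ ‖c + x • e₁ + y • e₂‖ ∧ |y| ≤ ‖c + x • e₁ + y • e₂‖

lemma IsSlice.integrable {c e₁ e₂ : V} (h : IsSlice c e₁ e₂) (F : 𝓢(V, ℂ)) :
    Integrable (fun p : ℝ × ℝ => F (c + p.1 • e₁ + p.2 • e₂)) := by
  obtain ⟨C, -, hC⟩ := exists_norm_schwartz_le F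
  refine (integrable_inv_mul_inv.const_mul C).mono' ?_ (Filter.Eventually.of_forall fun p => ?_)
  · exact (F.continuous.comp (by fun_prop)).aestronglyMeasurable
  · exact hC _ _ _ (h p.1 p.2).1 (h p.1 p.2).2

lemma integrable_schwartz_line {v e : V} (h : ∀ x : ℝ, |x| ≤ ‖v + x • e‖) (F : 𝓢(V, ℂ)) :
    Integrable (fun x : ℝ => F (v + x • e)) := by
  obtain ⟨C, -, hC⟩ := exists_norm_schwartz_le F
  refine (integrable_inv_one_add_sq.const_mul C).mono' ?_
    (Filter.Eventually.of_forall fun x => ?_)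
  · exact (F.continuous.comp (by fun_prop)).aestronglyMeasurable
  · simpa using hC _ x 0 (h x) (by simp)

lemma hasDerivAt_schwartz_line (F : 𝓢(V, ℂ)) (v e : V) (x : ℝ) :
    HasDerivAt (fun x : ℝ => F (v + x • e)) (LineDeriv.lineDerivOp e F (v + x • e)) x := by
  rw [SchwartzMap.lineDerivOp_apply_eq_fderiv]
  have h1 : HasDerivAt (fun x : ℝ => v + x • e) e x := by
    simpa using ((hasDerivAt_id x).smul_const e).const_add v
  exact (F.differentiableAt.hasFDerivAt (x := v + x • e)).comp_hasDerivAt x h1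

lemma FT1_schwartz_line {v e : V} (h : ∀ x : ℝ, |x| ≤ ‖v + x • e‖) (F : 𝓢(V, ℂ)) (ξ : ℝ) :
    FT1 (fun x => (F - LineDeriv.lineDerivOp e (LineDeriv.lineDerivOp e F)) (v + x • e)) ξ =
      (1 + (ξ : ℂ) ^ 2) * FT1 (fun x => F (v + x • e)) ξ :=
  FT1_sub_deriv_deriv (hasDerivAt_schwartz_line F v e)
    (hasDerivAt_schwartz_line (LineDeriv.lineDerivOp e F) v e) (integrable_schwartz_line h _)
    (integrable_schwartz_line h _) (integrable_schwartz_line h _) ξ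

lemma exists_norm_FT2_slice_le (F : 𝓢(V, ℂ)) (e₁ e₂ : V) : ∃ C : ℝ, 0 ≤ C ∧
    ∀ c, IsSlice c e₁ e₂ → ∀ ξ η : ℝ,
      ‖FT2 (fun x y => F (c + x • e₁ + y • e₂)) ξ η‖ ≤
        C * ((1 + ξ ^ 2)⁻¹ * (1 + η ^ 2)⁻¹) := by
  set A := F - LineDeriv.lineDerivOp e₂ (LineDeriv.lineDerivOp e₂ F) with hA
  set B := A - LineDeriv.lineDerivOp e₁ (LineDeriv.lineDerivOp e₁ A) with hB
  obtain ⟨C, hC0, hC⟩ := exists_norm_schwartz_le B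
  refine ⟨∫ x : ℝ, ∫ y : ℝ, C * ((1 + x ^ 2)⁻¹ * (1 + y ^ 2)⁻¹), by positivity,
    fun c hc ξ η => ?_⟩
  have e1 : FT2 (fun x y => A (c + x • e₁ + y • e₂)) ξ η =
      (1 + (η : ℂ) ^ 2) * FT2 (fun x y => F (c + x • e₁ + y • e₂)) ξ η := by
    rw [FT2_eq_FT1_FT1, FT2_eq_FT1_FT1, FT1, FT1, ← integral_const_mul]
    congr 1
    ext x
    rw [hA, FT1_schwartz_line (fun y => (hc x y).2)]
    ring
  have e2 : FT2 (fun x y => B (c + x • e₁ + y • e₂)) ξ η =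
      (1 + (ξ : ℂ) ^ 2) * FT2 (fun x y => A (c + x • e₁ + y • e₂)) ξ η := by
    rw [FT2_eq_FT1_FT1_swap (hc.integrable B), FT2_eq_FT1_FT1_swap (hc.integrable A), FT1, FT1,
      ← integral_const_mul]
    congr 1
    ext y
    have hcomm (G : 𝓢(V, ℂ)) : (fun x : ℝ => G (c + x • e₁ + y • e₂)) =
        fun x => G (c + y • e₂ + x • e₁) := by
      ext x
      rw [add_right_comm]
    rw [hcomm A, hcomm B, hB, FT1_schwartz_line (fun x => by
      rw [add_right_comm]; exact (hc x y).1)]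
    ring
  have e3 : ‖FT2 (fun x y => B (c + x • e₁ + y • e₂)) ξ η‖ ≤
      ∫ x : ℝ, ∫ y : ℝ, C * ((1 + x ^ 2)⁻¹ * (1 + y ^ 2)⁻¹) := by
    have hi : Integrable (fun p : ℝ × ℝ => C * ((1 + p.1 ^ 2)⁻¹ * (1 + p.2 ^ 2)⁻¹)) :=
      integrable_inv_mul_inv.const_mul C
    rw [FT2_eq_FT1_FT1]
    refine (norm_FT1_le _ _).trans (integral_mono_of_nonneg ?_ hi.integral_prod_left ?_)
    · exact Filter.Eventually.of_forall fun x => norm_nonneg _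
    · refine Filter.Eventually.of_forall fun x => (norm_FT1_le _ _).trans ?_
      refine integral_mono_of_nonneg (Filter.Eventually.of_forall fun y => norm_nonneg _)
        ((integrable_inv_one_add_sq.const_mul _).const_mul _) ?_
      exact Filter.Eventually.of_forall fun y => hC _ _ _ (hc x y).1 (hc x y).2
  have nrm (z : ℝ) : ‖(1 + (z : ℂ) ^ 2)‖ = 1 + z ^ 2 := by
    rw [show (1 + (z : ℂ) ^ 2) = ((1 + z ^ 2 : ℝ) : ℂ) by push_cast; ring,
      Complex.norm_of_nonneg (by positivity)]
  rw [e2, e1, norm_mul, norm_mul, nrm, nrm] at e3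
  rw [← mul_inv, ← div_eq_mul_inv, le_div_iff₀ (by positivity)]
  refine le_of_eq_of_le ?_ e3
  ring

end Slices

/-! ### The diagonal of the Duhamel solution -/

/-- Frequency profiles with enough regularity and decay to apply Fubini's theorem. -/
structure FreqDecay (C : ℝ) (φ : ℝ → ℝ → ℂ) : Prop where
  measurable : Measurable (fun p : ℝ × ℝ => φ p.1 p.2)
  continuous : ∀ ξ, Continuous (φ ξ)
  bound : ∀ ξ η, ‖φ ξ η‖ ≤ C * ((1 + ξ ^ 2)⁻¹ * (1 + η ^ 2)⁻¹)

/-- The convolution square of `ξ ↦ (1 + ξ²)⁻¹`. -/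
def decayEnvelope (ζ : ℝ) : ℝ := ∫ ξ : ℝ, (1 + ξ ^ 2)⁻¹ * (1 + (ζ - ξ) ^ 2)⁻¹

lemma integrable_shear_inv_mul_inv :
    Integrable (fun p : ℝ × ℝ => (1 + p.2 ^ 2)⁻¹ * (1 + (p.1 - p.2) ^ 2)⁻¹) :=
  integrable_inv_one_add_sq.convolution_integrand (ContinuousLinearMap.mul ℝ ℝ)
    integrable_inv_one_add_sq

lemma integrable_decayEnvelope : Integrable decayEnvelope :=
  integrable_shear_inv_mul_inv.integral_prod_left

lemma inv_one_add_sq_le_one (x : ℝ) : (1 + x ^ 2)⁻¹ ≤ 1 :=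
  inv_le_one_of_one_le₀ (by nlinarith [sq_nonneg x])

lemma integrable_inv_mul_inv_sub (ζ : ℝ) :
    Integrable (fun ξ : ℝ => (1 + ξ ^ 2)⁻¹ * (1 + (ζ - ξ) ^ 2)⁻¹) := by
  refine integrable_inv_one_add_sq.mono' (by fun_prop) (Filter.Eventually.of_forall fun ξ => ?_)
  rw [Real.norm_of_nonneg (by positivity)]
  exact mul_le_of_le_one_right (by positivity) (inv_one_add_sq_le_one _)

lemma decayEnvelope_le_pi (ζ : ℝ) : decayEnvelope ζ ≤ π := by
  rw [← integral_univ_inv_one_add_sq]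
  refine integral_mono (integrable_inv_mul_inv_sub ζ) integrable_inv_one_add_sq fun ξ => ?_
  exact mul_le_of_le_one_right (by positivity) (inv_one_add_sq_le_one _)

lemma norm_exp_I_mul {z : ℂ} (r : ℝ) (hz : z = Complex.I * r) : ‖Complex.exp z‖ = 1 := by
  rw [hz, mul_comm, Complex.norm_exp_ofReal_mul_I]

namespace FreqDecay

variable {C : ℝ} {φ : ℝ → ℝ → ℂ}

lemma norm_collapse_integrand_le (h : FreqDecay C φ) (t ζ ξ : ℝ) :
    ‖Complex.exp (Complex.I * t * (((ζ - ξ : ℝ) : ℂ) ^ 2 - (ξ : ℂ) ^ 2)) * φ ξ (ζ - ξ)‖ ≤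
      C * ((1 + ξ ^ 2)⁻¹ * (1 + (ζ - ξ) ^ 2)⁻¹) := by
  rw [norm_mul, norm_exp_I_mul (t * ((ζ - ξ) ^ 2 - ξ ^ 2)) (by push_cast; ring), one_mul]
  exact h.bound _ _

lemma nonneg (h : FreqDecay C φ) : 0 ≤ C := by
  simpa using (norm_nonneg _).trans (h.bound 0 0)

lemma measurable_collapse_integrand (h : FreqDecay C φ) (t : ℝ) :
    Measurable (fun p : ℝ × ℝ =>
      Complex.exp (Complex.I * t * (((p.1 - p.2 : ℝ) : ℂ) ^ 2 - (p.2 : ℂ) ^ 2)) *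
        φ p.2 (p.1 - p.2)) :=
  Measurable.mul (by fun_prop)
    (h.measurable.comp (measurable_snd.prodMk (measurable_fst.sub measurable_snd)))

lemma norm_collapse_le (h : FreqDecay C φ) (t ζ : ℝ) :
    ‖collapse φ t ζ‖ ≤ C * decayEnvelope ζ := by
  rw [collapse, norm_mul]
  have h1 : ‖(2 * (π : ℂ))⁻¹‖ ≤ 1 := by
    rw [norm_inv]
    apply inv_le_one_of_one_le₀
    rw [norm_mul, Complex.norm_real, Real.norm_of_nonneg Real.pi_pos.le]
    norm_num
    linarith [Real.pi_gt_three]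
  refine (mul_le_of_le_one_left (norm_nonneg _) h1).trans ?_
  rw [decayEnvelope, ← integral_const_mul]
  exact norm_integral_le_of_norm_le ((integrable_inv_mul_inv_sub ζ).const_mul C)
    (Filter.Eventually.of_forall fun ξ => h.norm_collapse_integrand_le t ζ ξ)

lemma continuous_collapse (h : FreqDecay C φ) (t : ℝ) : Continuous (collapse φ t) := by
  refine continuous_const.mul (continuous_of_dominated
    (bound := fun ξ => C * (1 + ξ ^ 2)⁻¹) (fun ζ => ?_) (fun ζ => ?_)
    (integrable_inv_one_add_sq.const_mul C) ?_)
  · exact ((h.measurable_collapse_integrand t).comp measurable_prodMk_left).aestronglyMeasurable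
  · refine Filter.Eventually.of_forall fun ξ =>
      (h.norm_collapse_integrand_le t ζ ξ).trans (mul_le_mul_of_nonneg_left ?_ h.nonneg)
    exact mul_le_of_le_one_right (by positivity) (inv_one_add_sq_le_one _)
  · refine Filter.Eventually.of_forall fun ξ => ?_
    have := h.continuous ξ
    fun_prop

lemma integrable_collapse (h : FreqDecay C φ) (t : ℝ) : Integrable (collapse φ t) :=
  (integrable_decayEnvelope.const_mul C).mono' (h.continuous_collapse t).aestronglyMeasurable
    (Filter.Eventually.of_forall fun ζ => h.norm_collapse_le t ζ)

end FreqDecay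

/-- The diagonal of the free evolution is the inverse Fourier transform of `collapse`. -/
lemma freeGamma_diag {C : ℝ} {Γ : ℝ → ℝ → ℂ} (h : FreqDecay C (FT2 Γ)) (t x : ℝ) :
    freeGamma Γ t x x = IFT1 (collapse (FT2 Γ) t) x := by
  set φ := FT2 Γ with hφ
  have shift (ξ : ℝ) : ∫ η : ℝ, Complex.exp (Complex.I * ((ξ : ℂ) * x + (η : ℂ) * x)) *
      (Complex.exp (Complex.I * t * ((η : ℂ) ^ 2 - (ξ : ℂ) ^ 2)) * φ ξ η) =
      ∫ ζ : ℝ, Complex.exp (Complex.I * ζ * x) *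
        (Complex.exp (Complex.I * t * (((ζ - ξ : ℝ) : ℂ) ^ 2 - (ξ : ℂ) ^ 2)) * φ ξ (ζ - ξ)) := by
    rw [← integral_sub_right_eq_self _ ξ]
    congr 1
    ext ζ
    congr 2
    push_cast
    ring
  have hi : Integrable (fun p : ℝ × ℝ => Complex.exp (Complex.I * p.1 * x) *
      (Complex.exp (Complex.I * t * (((p.1 - p.2 : ℝ) : ℂ) ^ 2 - (p.2 : ℂ) ^ 2)) *
        φ p.2 (p.1 - p.2))) := by
    refine (integrable_shear_inv_mul_inv.const_mul C).mono' ?_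
      (Filter.Eventually.of_forall fun p => ?_)
    · exact (Measurable.mul (by fun_prop)
        (h.measurable_collapse_integrand t)).aestronglyMeasurable
    · rw [norm_mul, norm_exp_I_mul (p.1 * x) (by push_cast; ring), one_mul]
      exact h.norm_collapse_integrand_le t p.1 p.2
  simp only [freeGamma, IFT2, IFT1, ← hφ, shift]
  rw [integral_integral_swap (f := fun ξ ζ : ℝ => Complex.exp (Complex.I * ζ * x) *
      (Complex.exp (Complex.I * t * (((ζ - ξ : ℝ) : ℂ) ^ 2 - (ξ : ℂ) ^ 2)) * φ ξ (ζ - ξ))) hi.swap,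
    sq, mul_inv, mul_assoc, ← integral_const_mul]
  congr 2
  ext ζ
  rw [integral_const_mul, collapse]
  ring

/-- The Fourier transform in `x` of the diagonal of the Duhamel solution. -/
def duhamelDensity (Γ₀ : ℝ → ℝ → ℂ) (F : ℝ → ℝ → ℝ → ℂ) (t ζ : ℝ) : ℂ :=
  collapse (FT2 Γ₀) t ζ + Complex.I * ∫ s in (0:ℝ)..t, collapse (FT2 (F s)) (t - s) ζ

section Duhamel

variable {C₀ C : ℝ} {Γ₀ : ℝ → ℝ → ℂ} {F : ℝ → ℝ → ℝ → ℂ}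

attribute [local irreducible] collapse FT2 in
lemma measurable_collapse_duhamel
    (hm : Measurable (fun p : ℝ × ℝ × ℝ => FT2 (F p.1) p.2.1 p.2.2)) :
    Measurable (fun p : ℝ × ℝ × ℝ => collapse (FT2 (F p.1)) (p.2.1 - p.1) p.2.2) := by
  have h1 : Measurable (fun p : ℝ × ℝ × ℝ => (p.1, p.2.1 - p.1, p.2.2)) := by fun_prop
  exact (measurable_collapse (φ := fun s => FT2 (F s)) hm).comp h1

attribute [local irreducible] collapse FT2 in
lemma integrable_collapse_duhamel
    (hm : Measurable (fun p : ℝ × ℝ × ℝ => FT2 (F p.1) p.2.1 p.2.2))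
    (h : ∀ s, FreqDecay C (FT2 (F s))) {t : ℝ} :
    Integrable (fun p : ℝ × ℝ => collapse (FT2 (F p.1)) (t - p.1) p.2)
      ((volume.restrict (Set.Ioc 0 t)).prod volume) := by
  have hb : Integrable (fun p : ℝ × ℝ => (1 : ℝ) * (C * decayEnvelope p.2))
      ((volume.restrict (Set.Ioc 0 t)).prod volume) :=
    (integrable_const (1 : ℝ)).mul_prod (integrable_decayEnvelope.const_mul C)
  refine hb.mono' ?_ (Filter.Eventually.of_forall fun p => ?_)
  · have h1 : Measurable (fun p : ℝ × ℝ => (p.1, t, p.2)) := by fun_prop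
    exact ((measurable_collapse_duhamel hm).comp h1).aestronglyMeasurable
  · rw [one_mul]
    exact (h p.1).norm_collapse_le _ _

lemma duhamelGamma_diag (h₀ : FreqDecay C₀ (FT2 Γ₀))
    (hm : Measurable (fun p : ℝ × ℝ × ℝ => FT2 (F p.1) p.2.1 p.2.2))
    (h : ∀ s, FreqDecay C (FT2 (F s))) {t : ℝ} (ht : 0 ≤ t) (x : ℝ) :
    duhamelGamma Γ₀ F t x x = IFT1 (duhamelDensity Γ₀ F t) x := by
  have hi := integrable_collapse_duhamel hm h (t := t)
  have hb {g : ℝ → ℂ} (hg : Integrable g) :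
      Integrable (fun ζ : ℝ => Complex.exp (Complex.I * ζ * x) * g ζ) := by
    refine hg.bdd_mul (c := 1) (by fun_prop) (Filter.Eventually.of_forall fun ζ => ?_)
    rw [norm_exp_I_mul (ζ * x) (by push_cast; ring)]
  have hswap : ∫ s in (0:ℝ)..t, IFT1 (collapse (FT2 (F s)) (t - s)) x =
      IFT1 (fun ζ => ∫ s in (0:ℝ)..t, collapse (FT2 (F s)) (t - s) ζ) x := by
    simp only [IFT1, intervalIntegral.integral_of_le ht]
    rw [integral_const_mul, integral_integral_swap]
    · simp only [integral_const_mul]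
    · refine hi.bdd_mul (c := 1) (f := fun p : ℝ × ℝ => Complex.exp (Complex.I * p.2 * x))
        (by fun_prop) (Filter.Eventually.of_forall fun p => ?_)
      rw [norm_exp_I_mul (p.2 * x) (by push_cast; ring)]
  simp only [duhamelGamma, freeGamma_diag h₀, freeGamma_diag (h _), hswap]
  simp only [IFT1, duhamelDensity, mul_add]
  rw [integral_add (hb (h₀.integrable_collapse t)) (hb ?_), mul_add]
  · congr 1
    simp only [mul_left_comm _ Complex.I, integral_const_mul]
  · simp only [intervalIntegral.integral_of_le ht]
    exact hi.integral_prod_right.const_mul _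

lemma integrable_duhamelDensity (h₀ : FreqDecay C₀ (FT2 Γ₀))
    (hm : Measurable (fun p : ℝ × ℝ × ℝ => FT2 (F p.1) p.2.1 p.2.2))
    (h : ∀ s, FreqDecay C (FT2 (F s))) {t : ℝ} (ht : 0 ≤ t) :
    Integrable (duhamelDensity Γ₀ F t) := by
  refine (h₀.integrable_collapse t).add (Integrable.const_mul ?_ _)
  simp only [intervalIntegral.integral_of_le ht]
  exact (integrable_collapse_duhamel hm h).integral_prod_right

attribute [local irreducible] collapse FT2 in
lemma continuous_duhamelDensity (h₀ : FreqDecay C₀ (FT2 Γ₀))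
    (hm : Measurable (fun p : ℝ × ℝ × ℝ => FT2 (F p.1) p.2.1 p.2.2))
    (h : ∀ s, FreqDecay C (FT2 (F s))) (t : ℝ) :
    Continuous (duhamelDensity Γ₀ F t) := by
  refine (h₀.continuous_collapse t).add (continuous_const.mul ?_)
  refine intervalIntegral.continuous_of_dominated_interval (bound := fun _ => C * π)
    (fun ζ => ?_) (fun ζ => ?_) (by simp) ?_
  · have h1 : Measurable (fun s : ℝ => (s, t, ζ)) := by fun_prop
    exact ((measurable_collapse_duhamel hm).comp h1).aestronglyMeasurable
  · exact Filter.Eventually.of_forall fun s _ => ((h s).norm_collapse_le _ _).trans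
      (mul_le_mul_of_nonneg_left (decayEnvelope_le_pi ζ) (h s).nonneg)
  · exact Filter.Eventually.of_forall fun s _ => (h s).continuous_collapse _

lemma enorm_FT1_duhamelGamma_le (h₀ : FreqDecay C₀ (FT2 Γ₀))
    (hm : Measurable (fun p : ℝ × ℝ × ℝ => FT2 (F p.1) p.2.1 p.2.2))
    (h : ∀ s, FreqDecay C (FT2 (F s))) {t : ℝ} (ht : 0 ≤ t) (ζ : ℝ) :
    ‖FT1 (fun a => duhamelGamma Γ₀ F t a a) ζ‖ₑ ≤ ‖duhamelDensity Γ₀ F t ζ‖ₑ := by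
  have e : (fun a => duhamelGamma Γ₀ F t a a) = IFT1 (duhamelDensity Γ₀ F t) :=
    funext fun x => duhamelGamma_diag h₀ hm h ht x
  rw [e]
  by_cases hi : Integrable (IFT1 (duhamelDensity Γ₀ F t))
  · rw [FT1_IFT1 (continuous_duhamelDensity h₀ hm h t) (integrable_duhamelDensity h₀ hm h ht) hi]
  · simp [FT1_of_not_integrable hi]

lemma enorm_duhamelDensity_le {t T : ℝ} (ht : t ∈ Set.Icc 0 T) (ζ : ℝ) :
    ‖duhamelDensity Γ₀ F t ζ‖ₑ ≤ ‖collapse (FT2 Γ₀) t ζ‖ₑ +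
      ∫⁻ s in Set.Icc (0:ℝ) T, ‖collapse (FT2 (F s)) (t - s) ζ‖ₑ := by
  refine (enorm_add_le _ _).trans (add_le_add_right ?_ _)
  rw [enorm_mul, ← ofReal_norm Complex.I, Complex.norm_I, ENNReal.ofReal_one, one_mul,
    intervalIntegral.integral_of_le ht.1]
  refine (enorm_integral_le_lintegral_enorm _).trans (lintegral_mono_set ?_)
  exact fun s hs => ⟨hs.1.le, hs.2.trans ht.2⟩

attribute [local irreducible] collapse FT2 FT1 duhamelGamma in
/-- The estimate at the level of frequency profiles. -/
lemma lintegral_absDx_sq_le (h₀ : FreqDecay C₀ (FT2 Γ₀))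
    (hm : Measurable (fun p : ℝ × ℝ × ℝ => FT2 (F p.1) p.2.1 p.2.2))
    (h : ∀ s, FreqDecay C (FT2 (F s))) (T : ℝ) :
    ∫⁻ t in Set.Icc (0:ℝ) T,
        ∫⁻ x, ‖absDx (1 / 2) (fun a => duhamelGamma Γ₀ F t a a) x‖ₑ ^ 2 ≤
      2 * (∫⁻ ξ, ∫⁻ η, ‖FT2 Γ₀ ξ η‖ₑ ^ 2) +
      2 * (∫⁻ s in Set.Icc (0:ℝ) T, (∫⁻ ξ, ∫⁻ η, ‖FT2 (F s) ξ η‖ₑ ^ 2) ^ (1 / 2 : ℝ)) ^ 2 := by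
  set w : ℝ → ℝ≥0∞ := fun ζ => ENNReal.ofReal (|ζ| ^ (1 / 2 : ℝ)) with hw
  set a : ℝ → ℝ → ℝ≥0∞ := fun t ζ => w ζ * ‖collapse (FT2 Γ₀) t ζ‖ₑ with ha
  set K : ℝ → ℝ × ℝ → ℝ≥0∞ := fun s p => w p.2 * ‖collapse (FT2 (F s)) (p.1 - s) p.2‖ₑ with hK
  have mw : Measurable w := by fun_prop
  have mK : Measurable (Function.uncurry K) :=
    (mw.comp (measurable_snd.comp measurable_snd)).mul (measurable_collapse_duhamel hm).enorm
  have ma : Measurable (fun p : ℝ × ℝ => a p.1 p.2) := by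
    have m := measurable_collapse_uncurry h₀.measurable
    exact (mw.comp measurable_snd).mul m.enorm
  set b : ℝ → ℝ → ℝ≥0∞ := fun t ζ => ∫⁻ s in Set.Icc (0:ℝ) T, K s (t, ζ) with hb
  have mb : Measurable (fun p : ℝ × ℝ => b p.1 p.2) := mK.lintegral_prod_left'
  have ma2 : Measurable (fun p : ℝ × ℝ => 2 * a p.1 p.2 ^ 2) := (ma.pow_const 2).const_mul 2
  have mb2 : Measurable (fun p : ℝ × ℝ => 2 * b p.1 p.2 ^ 2) := (mb.pow_const 2).const_mul 2
  have pointwise (t : ℝ) (ht : t ∈ Set.Icc (0:ℝ) T) :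
      ∫⁻ x, ‖absDx (1 / 2) (fun a => duhamelGamma Γ₀ F t a a) x‖ₑ ^ 2 ≤
        ∫⁻ ζ, (2 * a t ζ ^ 2 + 2 * b t ζ ^ 2) := by
    refine (lintegral_IFT1_sq_le _).trans ?_
    refine (mul_le_of_le_one_left zero_le ?_).trans (lintegral_mono fun ζ => ?_)
    · rw [ENNReal.ofReal_le_one]
      exact inv_le_one_of_one_le₀ (by linarith [Real.pi_gt_three])
    · have e1 : ‖((|ζ| ^ (1 / 2 : ℝ) : ℝ) : ℂ)‖ₑ = w ζ := by
        rw [← ofReal_norm, Complex.norm_of_nonneg (by positivity)]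
      have e2 : b t ζ = w ζ * ∫⁻ s in Set.Icc (0:ℝ) T, ‖collapse (FT2 (F s)) (t - s) ζ‖ₑ :=
        lintegral_const_mul' _ _ ENNReal.ofReal_ne_top
      calc ‖((|ζ| ^ (1 / 2 : ℝ) : ℝ) : ℂ) * FT1 (fun a => duhamelGamma Γ₀ F t a a) ζ‖ₑ ^ 2
          ≤ (a t ζ + b t ζ) ^ 2 := by
            rw [enorm_mul, e1, e2, ha, ← mul_add]
            gcongr
            exact (enorm_FT1_duhamelGamma_le h₀ hm h ht.1 ζ).trans (enorm_duhamelDensity_le ht ζ)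
        _ ≤ 2 * a t ζ ^ 2 + 2 * b t ζ ^ 2 := by
            have := ENNReal.rpow_add_le_mul_rpow_add_rpow (a t ζ) (b t ζ) one_le_two
            norm_num at this
            rwa [mul_add] at this
  calc _ ≤ ∫⁻ t in Set.Icc (0:ℝ) T, ∫⁻ ζ, (2 * a t ζ ^ 2 + 2 * b t ζ ^ 2) :=
        setLIntegral_mono' measurableSet_Icc pointwise
    _ ≤ ∫⁻ t, ∫⁻ ζ, (2 * a t ζ ^ 2 + 2 * b t ζ ^ 2) := setLIntegral_le_lintegral _ _
    _ = ∫⁻ p : ℝ × ℝ, (2 * a p.1 p.2 ^ 2 + 2 * b p.1 p.2 ^ 2) :=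
        lintegral_lintegral (f := fun t ζ => 2 * a t ζ ^ 2 + 2 * b t ζ ^ 2)
          (ma2.add mb2).aemeasurable
    _ = 2 * (∫⁻ p : ℝ × ℝ, a p.1 p.2 ^ 2) + 2 * ∫⁻ p : ℝ × ℝ, b p.1 p.2 ^ 2 := by
        rw [lintegral_add_left ma2, lintegral_const_mul' _ _ (by simp),
          lintegral_const_mul' _ _ (by simp)]
    _ ≤ _ := by
        gcongr
        · refine (lintegral_lintegral (f := fun t ζ => a t ζ ^ 2)
            (ma.pow_const 2).aemeasurable).symm.le.trans ?_
          exact lintegral_lintegral_collapse_sq_le h₀.measurable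
        · refine (lintegral_lintegral_sq_le mK).trans ?_
          gcongr with s
          have mKs : Measurable (fun p : ℝ × ℝ => K s p ^ 2) := mK.of_uncurry_left.pow_const 2
          calc ∫⁻ p, K s p ^ 2 = ∫⁻ t, ∫⁻ ζ, K s (t, ζ) ^ 2 :=
                (lintegral_lintegral (f := fun t ζ => K s (t, ζ) ^ 2) mKs.aemeasurable).symm
            _ = ∫⁻ t, ∫⁻ ζ, (w ζ * ‖collapse (FT2 (F s)) t ζ‖ₑ) ^ 2 :=
                lintegral_sub_right_eq_self
                  (fun t => ∫⁻ ζ, (w ζ * ‖collapse (FT2 (F s)) t ζ‖ₑ) ^ 2) s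
            _ ≤ _ := lintegral_lintegral_collapse_sq_le (h s).measurable

end Duhamel

lemma exists_freqDecay_slice {V : Type*} [NormedAddCommGroup V] [NormedSpace ℝ V]
    (F : 𝓢(V, ℂ)) (e₁ e₂ : V) : ∃ C : ℝ, ∀ c, IsSlice c e₁ e₂ →
      FreqDecay C (FT2 (fun x y => F (c + x • e₁ + y • e₂))) := by
  obtain ⟨C, -, hC⟩ := exists_norm_FT2_slice_le F e₁ e₂
  refine ⟨C, fun c hc => ⟨?_, fun ξ => ?_, hC c hc⟩⟩
  · exact measurable_FT2_uncurry
      (F.continuous.comp (by fun_prop : Continuous fun p : ℝ × ℝ => c + p.1 • e₁ + p.2 • e₂)).measurable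
  · exact (continuous_FT1 _).congr fun η => (FT2_eq_FT1_FT1_swap (hc.integrable F) ξ η).symm

lemma exists_freqDecay (Γ : 𝓢(ℝ × ℝ, ℂ)) :
    ∃ C : ℝ, FreqDecay C (FT2 (fun x y => Γ (x, y))) := by
  obtain ⟨C, hC⟩ := exists_freqDecay_slice Γ (1, 0) (0, 1)
  have h := hC 0 fun x y => by simp [Prod.norm_def]
  exact ⟨C, by simpa using h⟩

lemma exists_freqDecay_forcing (F : 𝓢(ℝ × ℝ × ℝ, ℂ)) :
    ∃ C : ℝ, ∀ s, FreqDecay C (FT2 (fun x y => F (s, x, y))) := by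
  obtain ⟨C, hC⟩ := exists_freqDecay_slice F (0, 1, 0) (0, 0, 1)
  refine ⟨C, fun s => ?_⟩
  have h := hC (s, 0, 0) fun x y => by simp [Prod.norm_def]
  simpa using h

/-! ### Norm bookkeeping -/

lemma L2K_sq {f : ℝ → ℝ → ℂ} (hf : Measurable (fun p : ℝ × ℝ => f p.1 p.2)) :
    L2K f ^ 2 = ∫⁻ x, ∫⁻ y, ‖f x y‖ₑ ^ 2 := by
  rw [L2K, eLpNorm_two_sq]
  exact (lintegral_lintegral (f := fun x y => ‖f x y‖ₑ ^ 2)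
    (hf.enorm.pow_const 2).aemeasurable).symm

lemma lintegral_FT2_sq_le_L2K {f : ℝ → ℝ → ℂ}
    (hf : Measurable (fun p : ℝ × ℝ => f p.1 p.2)) :
    ∫⁻ ξ, ∫⁻ η, ‖FT2 f ξ η‖ₑ ^ 2 ≤ (ENNReal.ofReal (2 * π) * L2K f) ^ 2 := by
  rw [mul_pow, L2K_sq hf]
  exact lintegral_FT2_sq_le hf

lemma MixedN2_two_sq_le (μ : Measure ℝ) (u : ℝ → ℝ → ℂ) :
    MixedN2 μ 2 2 u ^ 2 ≤ ∫⁻ t, (∫⁻ x, ‖u t x‖ₑ ^ 2) ∂μ := by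
  rw [MixedN2, eLpNorm_two_sq]
  refine lintegral_mono fun t => ?_
  rw [← eLpNorm_two_sq, ← ofReal_norm, Real.norm_of_nonneg ENNReal.toReal_nonneg]
  gcongr
  exact ENNReal.ofReal_toReal_le

/-- Inhomogeneous collapsing estimate for the Duhamel solution of `𝐒_± Γ = F`. -/
theorem inhomogeneous_collapsing_estimate :
    ∃ C : ℝ, 0 < C ∧ ∀ T : ℝ, 0 < T → ∀ Γ₀ : 𝓢(ℝ × ℝ, ℂ), ∀ F : 𝓢(ℝ × ℝ × ℝ, ℂ),
      MixedN2 (volume.restrict (Set.Icc (0:ℝ) T)) 2 2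
          (fun t x => absDx (1/2)
            (fun a => duhamelGamma (fun a b => Γ₀ (a, b)) (fun s a b => F (s, a, b)) t a a) x)
        ≤ ENNReal.ofReal C *
            (L2K (fun a b => Γ₀ (a, b)) +
              ∫⁻ s in Set.Icc (0:ℝ) T, L2K (fun a b => F (s, a, b))) := by
  refine ⟨4 * π, by positivity, fun T _ Γ₀ F => ?_⟩
  obtain ⟨C₀, h₀⟩ := exists_freqDecay Γ₀
  obtain ⟨C, h⟩ := exists_freqDecay_forcing F
  have mΓ : Measurable (fun p : ℝ × ℝ => Γ₀ (p.1, p.2)) := Γ₀.continuous.measurable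
  have mF : Measurable (fun p : ℝ × ℝ × ℝ => F (p.1, p.2.1, p.2.2)) := F.continuous.measurable
  have hm := measurable_FT2 (f := fun s a b => F (s, a, b)) mF
  rw [← (ENNReal.pow_right_strictMono two_ne_zero).le_iff_le]
  refine (MixedN2_two_sq_le _ _).trans ((lintegral_absDx_sq_le h₀ hm h T).trans ?_)
  set X := L2K (fun a b => Γ₀ (a, b))
  set Y := ∫⁻ s in Set.Icc (0:ℝ) T, L2K (fun a b => F (s, a, b)) with hY
  have hX := lintegral_FT2_sq_le_L2K (f := fun a b => Γ₀ (a, b)) mΓ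
  have hF : ∫⁻ s in Set.Icc (0:ℝ) T,
      (∫⁻ ξ, ∫⁻ η, ‖FT2 (fun a b => F (s, a, b)) ξ η‖ₑ ^ 2) ^ (1 / 2 : ℝ) ≤
        ENNReal.ofReal (2 * π) * Y := by
    rw [hY, ← lintegral_const_mul' _ _ ENNReal.ofReal_ne_top]
    refine lintegral_mono fun s => ?_
    have hs := lintegral_FT2_sq_le_L2K (f := fun a b => F (s, a, b))
      (mF.comp measurable_prodMk_left)
    refine (ENNReal.rpow_le_rpow hs (by norm_num : (0:ℝ) ≤ 1 / 2)).trans_eq ?_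
    rw [← ENNReal.rpow_natCast, ← ENNReal.rpow_mul]
    norm_num
  calc _ ≤ 2 * (ENNReal.ofReal (2 * π) * X) ^ 2 + 2 * (ENNReal.ofReal (2 * π) * Y) ^ 2 := by
        gcongr
    _ ≤ 4 * ENNReal.ofReal (2 * π) ^ 2 * (X + Y) ^ 2 := by
        calc _ = 2 * ENNReal.ofReal (2 * π) ^ 2 * (X ^ 2 + Y ^ 2) := by ring
          _ ≤ 4 * ENNReal.ofReal (2 * π) ^ 2 * (X + Y) ^ 2 := by
            gcongr
            · norm_num
            · calc X ^ 2 + Y ^ 2 ≤ X ^ 2 + Y ^ 2 + 2 * X * Y := le_self_add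
                _ = _ := by ring
    _ = (ENNReal.ofReal (4 * π) * (X + Y)) ^ 2 := by
        rw [show 4 * π = 2 * (2 * π) by ring, ENNReal.ofReal_mul (p := 2) (by norm_num)]
        norm_num
        ring

end
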